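/- Assume additionally r > 0, q ≥ 0 and β ≥ 1. Let f : O → ℝ be continuous and obey the elliptic growth condition, let ψ be continuous on O ∪ Γ₁ and obey the elliptic growth condition, and let g : Γ₁ → ℝ be continuous, obey the elliptic growth condition, and satisfy ψ ≤ g on Γ₁. If u₁ and u₂ are both continuous on O ∪ Γ₁, twice continuously differentiable on O, each uᵢ and A uᵢ obey the elliptic growth condition on O, and each uᵢ satisfies min{A uᵢ − f, uᵢ − ψ} = 0 on O and uᵢ = g on Γ₁ (i = 1, 2), then u₁ = u₂ on O ∪ Γ₁. -/

import Mathlib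

open Real Set MeasureTheory

noncomputable section

/-- First directional derivative of `u` at `z` in direction `v`. -/
def D1 (u : ℝ × ℝ → ℝ) (z v : ℝ × ℝ) : ℝ := fderiv ℝ u z v

/-- Second directional derivative of `u` at `z` in directions `v`, `w`. -/
def D2 (u : ℝ × ℝ → ℝ) (z v w : ℝ × ℝ) : ℝ := fderiv ℝ (fun z' => fderiv ℝ u z' v) z w

/-- The elliptic Heston operator
`(Au)(x,y) = −(y/2)(u_xx + 2ρσ u_xy + σ² u_yy) − (r − q − y/2) u_x − κ(θ − y) u_y + r u`. -/
def hestonA (σ ρ κ θ q r : ℝ) (u : ℝ × ℝ → ℝ) (z : ℝ × ℝ) : ℝ :=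
  -(z.2 / 2) * (D2 u z (1, 0) (1, 0) + 2 * ρ * σ * D2 u z (1, 0) (0, 1)
      + σ ^ 2 * D2 u z (0, 1) (0, 1))
    - (r - q - z.2 / 2) * D1 u z (1, 0) - κ * (θ - z.2) * D1 u z (0, 1) + r * u z

/-- The open upper half-plane `ℍ = ℝ × (0,∞)`. -/
def HH : Set (ℝ × ℝ) := {z | 0 < z.2}

/-- `Γ₁ = ∂O ∩ ℍ`. -/
def Gamma1 (O : Set (ℝ × ℝ)) : Set (ℝ × ℝ) := frontier O ∩ HH

/-- `Γ₀`: the interior, relative to `∂ℍ = ℝ × {0}`, of `∂ℍ ∩ ∂O`. -/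
def Gamma0 (O : Set (ℝ × ℝ)) : Set (ℝ × ℝ) :=
  {z | z.2 = 0 ∧ z.1 ∈ interior {x : ℝ | (x, (0 : ℝ)) ∈ frontier O}}

/-- The elliptic growth condition: `|v(x,y)| ≤ C (1 + e^{M₁ y} + e^{M₂ x})` on `S`,
with `0 ≤ M₁ < min (r/(κθ)) μ`, `μ = 2κ/σ²`, and `M₂ ∈ [0,1)`. -/
def ellGrowth (σ κ θ r : ℝ) (S : Set (ℝ × ℝ)) (v : ℝ × ℝ → ℝ) : Prop :=
  ∃ C M₁ M₂ : ℝ, 0 < C ∧ 0 ≤ M₁ ∧ M₁ < min (r / (κ * θ)) (2 * κ / σ ^ 2) ∧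
    0 ≤ M₂ ∧ M₂ < 1 ∧ ∀ z ∈ S, |v z| ≤ C * (1 + exp (M₁ * z.2) + exp (M₂ * z.1))

/-- `min{Au − f, u − ψ} = 0` on `O`: `Au ≥ f` and `u ≥ ψ` on `O`, and at each point of `O`
at least one of `Au = f`, `u = ψ` holds. -/
def obstacleProblem (σ ρ κ θ q r : ℝ) (O : Set (ℝ × ℝ)) (f ψ u : ℝ × ℝ → ℝ) : Prop :=
  ∀ z ∈ O, f z ≤ hestonA σ ρ κ θ q r u z ∧ ψ z ≤ u z ∧
    (hestonA σ ρ κ θ q r u z = f z ∨ u z = ψ z)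

open Filter Topology in
lemma D2_eq {u : ℝ × ℝ → ℝ} {z : ℝ × ℝ} (hu : ContDiffAt ℝ 2 u z) (v w : ℝ × ℝ) :
    D2 u z v w = fderiv ℝ (fderiv ℝ u) z w v := by
  have hd : DifferentiableAt ℝ (fderiv ℝ u) z :=
    (hu.fderiv_right (m := 1) (by norm_num)).differentiableAt (by norm_num)
  unfold D2
  rw [fderiv_clm_apply hd (differentiableAt_const v)]
  simp

open Filter Topology in
lemma fderiv_sub_eventually {u w : ℝ × ℝ → ℝ} {z : ℝ × ℝ} (hu : ContDiffAt ℝ 2 u z)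
    (hw : ContDiffAt ℝ 2 w z) :
    fderiv ℝ (fun p => u p - w p) =ᶠ[𝓝 z] fun p => fderiv ℝ u p - fderiv ℝ w p := by
  filter_upwards [hu.eventually (by simp), hw.eventually (by simp)] with p hp hq
  exact fderiv_fun_sub (hp.differentiableAt (by norm_num)) (hq.differentiableAt (by norm_num))

lemma D2_sub {u w : ℝ × ℝ → ℝ} {z : ℝ × ℝ} (hu : ContDiffAt ℝ 2 u z)
    (hw : ContDiffAt ℝ 2 w z) (v v' : ℝ × ℝ) :
    D2 (fun p => u p - w p) z v v' = D2 u z v v' - D2 w z v v' := by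
  have hd : DifferentiableAt ℝ (fderiv ℝ u) z :=
    (hu.fderiv_right (m := 1) (by norm_num)).differentiableAt (by norm_num)
  have hd' : DifferentiableAt ℝ (fderiv ℝ w) z :=
    (hw.fderiv_right (m := 1) (by norm_num)).differentiableAt (by norm_num)
  rw [D2_eq (hu.sub hw), D2_eq hu, D2_eq hw, (fderiv_sub_eventually hu hw).fderiv_eq,
    fderiv_fun_sub hd hd']
  simp

lemma hestonA_sub (σ ρ κ θ q r : ℝ) {u w : ℝ × ℝ → ℝ} {z : ℝ × ℝ} (hu : ContDiffAt ℝ 2 u z)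
    (hw : ContDiffAt ℝ 2 w z) :
    hestonA σ ρ κ θ q r (fun p => u p - w p) z
      = hestonA σ ρ κ θ q r u z - hestonA σ ρ κ θ q r w z := by
  have h1 : ∀ v, D1 (fun p => u p - w p) z v = D1 u z v - D1 w z v := by
    intro v
    unfold D1
    rw [fderiv_fun_sub (hu.differentiableAt (by norm_num)) (hw.differentiableAt (by norm_num))]
    simp
  unfold hestonA
  simp only [h1, D2_sub hu hw]
  ring

lemma hestonA_smul (σ ρ κ θ q r ε : ℝ) {w : ℝ × ℝ → ℝ} {z : ℝ × ℝ} (hw : ContDiffAt ℝ 2 w z) :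
    hestonA σ ρ κ θ q r (fun p => ε * w p) z = ε * hestonA σ ρ κ θ q r w z := by
  have h1 : ∀ p v, D1 (fun p => ε * w p) p v = ε * D1 w p v := by
    intro p v
    unfold D1
    change fderiv ℝ (ε • w) p v = _
    rw [fderiv_const_smul_field]
    simp
  have h2 : ∀ v v', D2 (fun p => ε * w p) z v v' = ε * D2 w z v v' := by
    intro v v'
    have : (fun p => fderiv ℝ (fun p => ε * w p) p v) = ε • (fun p => fderiv ℝ w p v) := by
      funext p; exact h1 p v
    unfold D2
    rw [this, fderiv_const_smul_field]
    simp
  unfold hestonA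
  simp only [h1, h2]
  ring

open Filter Topology in
lemma D2_nonpos {u : ℝ × ℝ → ℝ} {z : ℝ × ℝ} (hu : ContDiffAt ℝ 2 u z) (hmax : IsLocalMax u z)
    (w : ℝ × ℝ) : D2 u z w w ≤ 0 := by
  by_contra! hpos
  set l : ℝ → ℝ × ℝ := fun t => z + t • w with hl
  have hlc : Continuous l := by fun_prop
  have hl0 : l 0 = z := by simp [hl]
  have hld : ∀ t, HasDerivAt l w t := by
    intro t
    have h : HasDerivAt (fun t : ℝ => t • w) ((1 : ℝ) • w) t := (hasDerivAt_id t).smul_const w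
    rw [one_smul] at h
    exact h.const_add z
  set g : ℝ → ℝ := fun t => u (l t) with hg
  have hl0' : Tendsto l (𝓝 0) (𝓝 z) := by
    have := hlc.tendsto 0
    rwa [hl0] at this
  have hg1 : deriv g =ᶠ[𝓝 0] fun t => fderiv ℝ u (l t) w := by
    filter_upwards [hl0'.eventually (hu.eventually (by simp))] with t ht
    exact ((ht.differentiableAt (by norm_num)).hasFDerivAt.comp_hasDerivAt t (hld t)).deriv
  have hd : DifferentiableAt ℝ (fderiv ℝ u) z :=
    (hu.fderiv_right (m := 1) (by norm_num)).differentiableAt (by norm_num)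
  have hd2 : DifferentiableAt ℝ (fun p => fderiv ℝ u p w) (l 0) := by
    rw [hl0]
    exact hd.clm_apply (differentiableAt_const w)
  have hg2 : deriv (deriv g) 0 = D2 u z w w := by
    rw [hg1.deriv_eq]
    have := (hd2.hasFDerivAt.comp_hasDerivAt (0 : ℝ) (hld 0)).deriv
    rw [hl0] at this
    exact this
  have hgmax : IsLocalMax g 0 := by
    have h : ∀ᶠ p in 𝓝 z, u p ≤ u z := hmax
    have := hl0'.eventually h
    filter_upwards [this] with t ht
    simpa [hg, hl0] using ht
  have hgc : ContinuousAt g 0 := by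
    have : ContinuousAt u (l 0) := by rw [hl0]; exact hu.continuousAt
    exact this.comp hlc.continuousAt
  have hgmin : IsLocalMin g 0 :=
    isLocalMin_of_deriv_deriv_pos (by rw [hg2]; exact hpos) hgmax.deriv_eq_zero hgc
  have hconst : g =ᶠ[𝓝 0] fun _ => g 0 := by
    filter_upwards [hgmin, hgmax] with t h1 h2
    exact le_antisymm h2 h1
  have : deriv (deriv g) 0 = 0 := by
    rw [hconst.deriv.deriv_eq]
    simp
  rw [hg2] at this
  linarith

lemma hestonA_at_max (σ ρ κ θ q r : ℝ) (hρ₁ : -1 < ρ) (hρ₂ : ρ < 1) {u : ℝ × ℝ → ℝ} {z : ℝ × ℝ}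
    (hz : 0 < z.2) (hu : ContDiffAt ℝ 2 u z) (hmax : IsLocalMax u z) :
    r * u z ≤ hestonA σ ρ κ θ q r u z := by
  have h1 : ∀ v, D1 u z v = 0 := by
    intro v
    unfold D1
    rw [hmax.fderiv_eq_zero]
    simp
  have ha := D2_nonpos hu hmax (1, ρ * σ)
  have hb := D2_nonpos hu hmax (0, 1)
  have hsym : IsSymmSndFDerivAt ℝ u z :=
    hu.isSymmSndFDerivAt (by rw [minSmoothness_of_isRCLikeNormedField])
  have hs := hsym (1, 0) (0, 1)
  have hdec : ((1, ρ * σ) : ℝ × ℝ) = (1, 0) + (ρ * σ) • (0, 1) := by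
    ext <;> simp
  have hexp : D2 u z (1, ρ * σ) (1, ρ * σ) = D2 u z (1, 0) (1, 0)
      + 2 * ρ * σ * D2 u z (1, 0) (0, 1) + ρ ^ 2 * σ ^ 2 * D2 u z (0, 1) (0, 1) := by
    rw [hdec]
    simp only [D2_eq hu, map_add, map_smul, ContinuousLinearMap.add_apply,
      ContinuousLinearMap.smul_apply, smul_eq_mul]
    rw [hs]
    ring
  unfold hestonA
  rw [h1, h1]
  rw [hexp] at ha
  have hρ : 0 ≤ (1 - ρ ^ 2) * σ ^ 2 := mul_nonneg (by nlinarith) (sq_nonneg _)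
  have : D2 u z (1, 0) (1, 0) + 2 * ρ * σ * D2 u z (1, 0) (0, 1)
      + σ ^ 2 * D2 u z (0, 1) (0, 1) ≤ 0 := by
    nlinarith [mul_nonneg hρ (neg_nonneg.2 hb)]
  nlinarith [mul_nonneg hz.le (neg_nonneg.2 this)]

open Filter Topology in
lemma hestonA_sep (σ ρ κ θ q r : ℝ) {a a' a'' b b' b'' : ℝ → ℝ}
    (ha : ∀ x, HasDerivAt a (a' x) x) (ha' : ∀ x, HasDerivAt a' (a'' x) x)
    (hb : ∀ y, 0 < y → HasDerivAt b (b' y) y) (hb' : ∀ y, 0 < y → HasDerivAt b' (b'' y) y)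
    {z : ℝ × ℝ} (hz : 0 < z.2) :
    hestonA σ ρ κ θ q r (fun p => a p.1 + b p.2) z =
      -(z.2 / 2) * (a'' z.1 + σ ^ 2 * b'' z.2) - (r - q - z.2 / 2) * a' z.1
        - κ * (θ - z.2) * b' z.2 + r * (a z.1 + b z.2) := by
  have key : ∀ (a a' b b' : ℝ → ℝ) (z : ℝ × ℝ) (v : ℝ × ℝ), HasDerivAt a (a' z.1) z.1 →
      HasDerivAt b (b' z.2) z.2 →
      fderiv ℝ (fun p : ℝ × ℝ => a p.1 + b p.2) z v = a' z.1 * v.1 + b' z.2 * v.2 := by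
    intro a a' b b' z v ha hb
    have h1 := ha.comp_hasFDerivAt z (hasFDerivAt_fst (𝕜 := ℝ) (p := z))
    have h2 := hb.comp_hasFDerivAt z (hasFDerivAt_snd (𝕜 := ℝ) (p := z))
    have h3 := (h1.add h2).fderiv
    have h4 : fderiv ℝ (fun p : ℝ × ℝ => a p.1 + b p.2) z = _ := h3
    rw [h4]
    simp
  have hopen : ∀ᶠ p : ℝ × ℝ in 𝓝 z, 0 < p.2 :=
    (continuous_snd.tendsto z).eventually (lt_mem_nhds hz)
  have h1 : ∀ v, D1 (fun p : ℝ × ℝ => a p.1 + b p.2) z v = a' z.1 * v.1 + b' z.2 * v.2 :=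
    fun v => key a a' b b' z v (ha _) (hb _ hz)
  have h2 : ∀ v w, D2 (fun p : ℝ × ℝ => a p.1 + b p.2) z v w
      = (a'' z.1 * v.1) * w.1 + (b'' z.2 * v.2) * w.2 := by
    intro v w
    have he : (fun p => fderiv ℝ (fun p : ℝ × ℝ => a p.1 + b p.2) p v) =ᶠ[𝓝 z]
        fun p => (fun x => a' x * v.1) p.1 + (fun y => b' y * v.2) p.2 := by
      filter_upwards [hopen] with p hp
      exact key a a' b b' p v (ha _) (hb _ hp)
    unfold D2
    rw [he.fderiv_eq]
    exact key (fun x => a' x * v.1) (fun x => a'' x * v.1) (fun x => b' x * v.2)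
      (fun x => b'' x * v.2) z w ((ha' _).mul_const _) ((hb' _ hz).mul_const _)
  unfold hestonA
  simp only [h1, h2]
  ring

set_option maxHeartbeats 1000000 in
lemma barrier_exists (σ ρ κ θ q r M N : ℝ) (hσ : σ ≠ 0)
    (hκ : 0 < κ) (hθ : 0 < θ) (hr : 0 < r) (hq : 0 ≤ q)
    (hβ : 1 ≤ 2 * κ * θ / σ ^ 2) (hM0 : 0 < M) (hM1 : M < r / (κ * θ)) (hM2 : M < 2 * κ / σ ^ 2)
    (hN0 : 0 < N) (hN1 : N < 1) :
    ∃ W : ℝ × ℝ → ℝ, ∀ z : ℝ × ℝ, 0 < z.2 → ContDiffAt ℝ 2 W z ∧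
      0 < hestonA σ ρ κ θ q r W z ∧ 0 ≤ W z ∧
      exp (M * z.2) + exp (N * z.1) + log (1 + z.1 ^ 2) + 2 * z.2 - log z.2 ≤ W z := by
  have hσ2 : 0 < σ ^ 2 := by positivity
  have hF : σ ^ 2 ≤ 2 * κ * θ := by rwa [le_div_iff₀ hσ2, one_mul] at hβ
  have hM1' : κ * θ * M < r := by
    rw [lt_div_iff₀ (by positivity)] at hM1; linarith
  have hM2' : σ ^ 2 * M < 2 * κ := by
    rw [lt_div_iff₀ hσ2] at hM2; linarith
  set c := M * (κ - σ ^ 2 * M / 2) with hc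
  have hc0 : 0 < c := mul_pos hM0 (by linarith)
  obtain ⟨K, hK1, hK2, hK3⟩ : ∃ K : ℝ, 1 ≤ K ∧ 2 ≤ (K - 1) * M ∧ 3 / 2 + r ≤ K * c := by
    refine ⟨1 + 2 / M + (3 / 2 + r) / c, ?_, ?_, ?_⟩
    · have : 0 ≤ 2 / M + (3 / 2 + r) / c := by positivity
      linarith
    · have : 0 ≤ (3 / 2 + r) / c * M := by positivity
      have h2 : 2 / M * M = 2 := by field_simp
      nlinarith
    · have : 0 ≤ (1 + 2 / M) * c := by positivity
      have h2 : (3 / 2 + r) / c * c = 3 / 2 + r := by field_simp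
      nlinarith
  obtain ⟨K', hK'0, hK'⟩ : ∃ K' : ℝ, 0 ≤ K' ∧ |r - q| + κ + 1 ≤ r * K' :=
    ⟨(|r - q| + κ + 1) / r, by positivity, by field_simp; exact le_refl _⟩
  set a : ℝ → ℝ := fun x => exp (N * x) + log (1 + x ^ 2) with ha
  set b : ℝ → ℝ := fun y => K * exp (M * y) - log y + K' with hb
  refine ⟨fun p => a p.1 + b p.2, ?_⟩
  rintro ⟨x, y⟩ hy
  simp only at hy
  have hx0 : ∀ x : ℝ, 0 < 1 + x ^ 2 := fun x => by positivity
  have hlx : 0 ≤ log (1 + x ^ 2) := log_nonneg (by nlinarith [sq_nonneg x])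
  have hEN : 0 < exp (N * x) := exp_pos _
  have hEM : M * y + 1 ≤ exp (M * y) := add_one_le_exp _
  have hly : log y ≤ y - 1 := log_le_sub_one_of_pos hy
  have hMy : 0 < M * y := mul_pos hM0 hy
  have hlow : exp (M * y) + exp (N * x) + log (1 + x ^ 2) + 2 * y - log y ≤ a x + b y := by
    simp only [ha, hb]
    have : (K - 1) * (M * y + 1) ≤ (K - 1) * exp (M * y) :=
      mul_le_mul_of_nonneg_left hEM (by linarith)
    have h3 : 2 * y ≤ (K - 1) * M * y := mul_le_mul_of_nonneg_right hK2 hy.le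
    nlinarith
  refine ⟨?_, ?_, ?_, hlow⟩
  · have h1 : ContDiffAt ℝ 2 (fun p : ℝ × ℝ => log (1 + p.1 ^ 2)) (x, y) :=
      ContDiffAt.log (by fun_prop) (hx0 x).ne'
    have h2 : ContDiffAt ℝ 2 (fun p : ℝ × ℝ => log p.2) (x, y) :=
      ContDiffAt.log (by fun_prop) hy.ne'
    have h3 : ContDiffAt ℝ 2 (fun p : ℝ × ℝ => exp (N * p.1)) (x, y) := by fun_prop
    have h4 : ContDiffAt ℝ 2 (fun p : ℝ × ℝ => K * exp (M * p.2)) (x, y) := by fun_prop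
    exact (h3.add h1).add ((h4.sub h2).add contDiffAt_const)
  · have he : ∀ s t : ℝ, HasDerivAt (fun x => exp (s * x)) (s * exp (s * t)) t := by
      intro s t
      have := ((hasDerivAt_id t).const_mul s).exp
      simpa [mul_comm] using this
    have hp : ∀ t : ℝ, HasDerivAt (fun x : ℝ => 1 + x ^ 2) (2 * t) t := by
      intro t
      simpa using ((hasDerivAt_pow 2 t)).const_add 1
    rw [hestonA_sep σ ρ κ θ q r (a := a) (b := b)
      (a' := fun x => N * exp (N * x) + 2 * x / (1 + x ^ 2))
      (a'' := fun x => N * (N * exp (N * x)) + (2 * (1 + x ^ 2) - 2 * x * (2 * x)) / (1 + x ^ 2) ^ 2)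
      (b' := fun y => K * (M * exp (M * y)) - y⁻¹)
      (b'' := fun y => K * (M * (M * exp (M * y))) - (-(y ^ 2)⁻¹))
      (fun t => (he N t).add ((hp t).log (hx0 t).ne'))
      (fun t => ((he N t).const_mul N).add (by
        have h := ((hasDerivAt_id t).const_mul 2).div (hp t) (hx0 t).ne'
        simp only [id, mul_one] at h
        exact h))
      (fun t ht => (((he M t).const_mul K).sub (hasDerivAt_log ht.ne')).add_const K')
      (fun t ht => (((he M t).const_mul M).const_mul K).sub (hasDerivAt_inv ht.ne')) (by exact hy)]
    simp only [ha, hb]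
    set E := exp (M * y)
    set G := exp (N * x)
    set h1 := 2 * x / (1 + x ^ 2) with hh1
    set h2 := (2 * (1 + x ^ 2) - 2 * x * (2 * x)) / (1 + x ^ 2) ^ 2 with hh2
    have b1 : h1 ≤ 1 := by
      rw [hh1, div_le_one (hx0 x)]; nlinarith [sq_nonneg (x - 1)]
    have b1' : -1 ≤ h1 := by
      rw [hh1, le_div_iff₀ (hx0 x)]; nlinarith [sq_nonneg (x + 1)]
    have b2 : h2 ≤ 2 := by
      rw [hh2, div_le_iff₀ (by positivity)]; nlinarith [sq_nonneg x, sq_nonneg (x ^ 2)]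
    have t1 : 0 ≤ G * ((y / 2) * N * (1 - N) + r * (1 - N) + q * N) := by
      have : 0 < 1 - N := by linarith
      positivity
    have t2 : -(3 / 2) * y - |r - q| ≤ -(y / 2) * (h2 - h1) - (r - q) * h1
        + r * log (1 + x ^ 2) := by
      have : (r - q) * h1 ≤ |r - q| := by
        calc (r - q) * h1 ≤ |(r - q) * h1| := le_abs_self _
          _ = |r - q| * |h1| := abs_mul _ _
          _ ≤ |r - q| * 1 := by gcongr; exact abs_le.2 ⟨b1', b1⟩
          _ = _ := mul_one _
      have : 0 ≤ r * log (1 + x ^ 2) := by positivity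
      have h5 : y * (h2 - h1) ≤ y * 3 := mul_le_mul_of_nonneg_left (by linarith) hy.le
      linarith
    have t3 : -κ - r * y ≤ (κ * θ - σ ^ 2 / 2) * y⁻¹ - κ - r * log y := by
      have : 0 ≤ (κ * θ - σ ^ 2 / 2) * y⁻¹ := mul_nonneg (by linarith) (by positivity)
      have h5 : r * log y ≤ r * y := mul_le_mul_of_nonneg_left (by linarith) hr.le
      linarith
    have t4 : (3 / 2 + r) * y ≤ K * E * ((r - κ * θ * M) + y * c) := by
      have e1 : 1 ≤ E := by linarith
      have e2 : 0 ≤ K * E * (r - κ * θ * M) :=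
        mul_nonneg (by positivity) (by linarith)
      have e3 : K * c * y * 1 ≤ K * c * y * E := by gcongr
      have e4 : (3 / 2 + r) * y ≤ K * c * y := by gcongr
      have e5 : K * E * ((r - κ * θ * M) + y * c)
          = K * E * (r - κ * θ * M) + K * c * y * E := by ring
      linarith
    have hyi : y * (y ^ 2)⁻¹ = y⁻¹ := by field_simp
    have hyi2 : y * y⁻¹ = 1 := by field_simp
    have hid : -(y / 2) * (N * (N * G) + h2 + σ ^ 2 * (K * (M * (M * E)) - -(y ^ 2)⁻¹))
        - (r - q - y / 2) * (N * G + h1) - κ * (θ - y) * (K * (M * E) - y⁻¹)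
        + r * (G + log (1 + x ^ 2) + (K * E - log y + K'))
        = G * ((y / 2) * N * (1 - N) + r * (1 - N) + q * N)
        + (-(y / 2) * (h2 - h1) - (r - q) * h1 + r * log (1 + x ^ 2))
        + ((κ * θ - σ ^ 2 / 2) * y⁻¹ - κ - r * log y)
        + K * E * ((r - κ * θ * M) + y * c) + r * K' := by
      rw [hc]
      linear_combination (-(σ ^ 2) / 2) * hyi - κ * hyi2
    rw [hid]
    linarith
  · change 0 ≤ a x + b y
    have : 0 < exp (M * y) := exp_pos _
    linarith

lemma exp_dominate {a b : ℝ} (ha : 0 ≤ a) (hab : a < b) {C ε : ℝ} (hC : 0 < C) (hε : 0 < ε) :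
    ∃ D : ℝ, 0 ≤ D ∧ ∀ t : ℝ, C * exp (a * t) ≤ ε * exp (b * t) + D := by
  refine ⟨C * exp (a * (log (C / ε) / (b - a))), by positivity, fun t => ?_⟩
  by_cases h : C * exp (a * t) ≤ ε * exp (b * t)
  · have : 0 < C * exp (a * (log (C / ε) / (b - a))) := by positivity
    linarith
  · push Not at h
    have h1 : exp ((b - a) * t) < C / ε := by
      rw [sub_mul, exp_sub, div_lt_div_iff₀ (exp_pos _) hε]
      linarith
    have h2 : (b - a) * t < log (C / ε) := (lt_log_iff_exp_lt (by positivity)).2 h1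
    have h3 : t ≤ log (C / ε) / (b - a) := by
      rw [le_div_iff₀ (by linarith)]; linarith
    have h4 : C * exp (a * t) ≤ C * exp (a * (log (C / ε) / (b - a))) := by gcongr
    have : 0 < ε * exp (b * t) := by positivity
    linarith

lemma growth_diff {σ κ θ r : ℝ} {O : Set (ℝ × ℝ)} {u₁ u₂ : ℝ × ℝ → ℝ} (hO : O ⊆ HH)
    (h₁ : ellGrowth σ κ θ r O u₁) (h₂ : ellGrowth σ κ θ r O u₂) :
    ellGrowth σ κ θ r O (fun z => u₁ z - u₂ z) := by
  obtain ⟨C, M, N, hC, hM0, hM, hN0, hN, h⟩ := h₁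
  obtain ⟨C', M', N', hC', hM0', hM', hN0', hN', h'⟩ := h₂
  refine ⟨2 * (C + C'), max M M', max N N', by positivity, le_max_of_le_left hM0, max_lt hM hM',
    le_max_of_le_left hN0, max_lt hN hN', fun z hz => ?_⟩
  have hz2 : 0 < z.2 := hO hz
  have key : ∀ N N'' : ℝ, 0 ≤ N → N ≤ N'' → exp (N * z.1) ≤ 1 + exp (N'' * z.1) := by
    intro N N'' h0 hle
    rcases le_total z.1 0 with hx | hx
    · have : exp (N * z.1) ≤ 1 := exp_le_one_iff.2 (mul_nonpos_of_nonneg_of_nonpos h0 hx)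
      linarith [exp_pos (N'' * z.1)]
    · have : exp (N * z.1) ≤ exp (N'' * z.1) := by gcongr
      linarith
  have a1 := key N (max N N') hN0 (le_max_left _ _)
  have a2 := key N' (max N N') hN0' (le_max_right _ _)
  have a3 : exp (M * z.2) ≤ exp (max M M' * z.2) := by gcongr; exact le_max_left _ _
  have a4 : exp (M' * z.2) ≤ exp (max M M' * z.2) := by gcongr; exact le_max_right _ _
  have p1 := exp_pos (max M M' * z.2)
  have p2 := exp_pos (max N N' * z.1)
  have b1 : |u₁ z| ≤ C * (2 * (1 + exp (max M M' * z.2) + exp (max N N' * z.1))) :=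
    (h z hz).trans (mul_le_mul_of_nonneg_left (by linarith) hC.le)
  have b2 : |u₂ z| ≤ C' * (2 * (1 + exp (max M M' * z.2) + exp (max N N' * z.1))) :=
    (h' z hz).trans (mul_le_mul_of_nonneg_left (by linarith) hC'.le)
  have := abs_sub (u₁ z) (u₂ z)
  calc |u₁ z - u₂ z| ≤ |u₁ z| + |u₂ z| := this
    _ ≤ _ := by linarith

open Filter Topology in
lemma heston_comparison
    (σ ρ κ θ q r : ℝ) (hσ : σ ≠ 0) (hρ₁ : -1 < ρ) (hρ₂ : ρ < 1)
    (hκ : 0 < κ) (hθ : 0 < θ) (hr : 0 < r) (hq : 0 ≤ q)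
    (hβ : 1 ≤ 2 * κ * θ / σ ^ 2)
    (O : Set (ℝ × ℝ)) (hO : IsOpen O) (hOsub : O ⊆ HH)
    (f ψ u₁ u₂ : ℝ × ℝ → ℝ)
    (hu₁c : ContinuousOn u₁ (O ∪ Gamma1 O)) (hu₁d : ContDiffOn ℝ 2 u₁ O)
    (hu₁g : ellGrowth σ κ θ r O u₁)
    (hu₁eq : obstacleProblem σ ρ κ θ q r O f ψ u₁)
    (hu₂c : ContinuousOn u₂ (O ∪ Gamma1 O)) (hu₂d : ContDiffOn ℝ 2 u₂ O)
    (hu₂g : ellGrowth σ κ θ r O u₂)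
    (hu₂eq : obstacleProblem σ ρ κ θ q r O f ψ u₂)
    (hb : ∀ z ∈ Gamma1 O, u₁ z = u₂ z) :
    ∀ z ∈ O, u₁ z ≤ u₂ z := by
  intro z₀ hz₀
  by_contra! hlt
  obtain ⟨C, M₁, M₂, hC, hM0, hM, hN0, hN, hgr⟩ := growth_diff hOsub hu₁g hu₂g
  obtain ⟨M, hM₁, hM'⟩ := exists_between hM
  obtain ⟨N, hN₁, hN'⟩ := exists_between hN
  obtain ⟨W, hW⟩ := barrier_exists σ ρ κ θ q r M N hσ hκ hθ hr hq hβ (by linarith)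
    (hM'.trans_le (min_le_left _ _)) (hM'.trans_le (min_le_right _ _)) (by linarith) hN'
  have hW0 : 0 ≤ W z₀ := (hW z₀ (hOsub hz₀)).2.2.1
  set d := u₁ z₀ - u₂ z₀ with hd
  have hd0 : 0 < d := by linarith
  obtain ⟨ε, hε, hεW⟩ : ∃ ε : ℝ, 0 < ε ∧ ε * W z₀ < d := by
    refine ⟨d / (W z₀ + 1), by positivity, ?_⟩
    rw [div_mul_eq_mul_div, div_lt_iff₀ (by linarith)]
    nlinarith
  obtain ⟨D₁, hD₁0, hD₁⟩ := exp_dominate hM0 hM₁ hC hε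
  obtain ⟨D₂, hD₂0, hD₂⟩ := exp_dominate hN0 hN₁ hC hε
  set L := (C + D₁ + D₂) / ε with hL
  set φ : ℝ × ℝ → ℝ := fun p => (u₁ p - u₂ p) - ε * W p with hφ
  set B : Set (ℝ × ℝ) := Icc (-exp L) (exp L) ×ˢ Icc (exp (-L)) L with hB
  have hBc : IsCompact B := isCompact_Icc.prod isCompact_Icc
  have hBH : B ⊆ HH := fun z hz => (exp_pos _).trans_le hz.2.1
  have hsub : closure O ∩ B ⊆ O ∪ Gamma1 O := by
    rintro z ⟨hz, hzB⟩
    by_cases h : z ∈ O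
    · exact Or.inl h
    · exact Or.inr ⟨⟨hz, by rwa [hO.interior_eq]⟩, hBH hzB⟩
  have hout : ∀ z ∈ O, 0 ≤ φ z → z ∈ B := by
    intro z hz hpos
    have hy : 0 < z.2 := hOsub hz
    have h1 := (hW z hy).2.2.2
    have h2 := (le_abs_self _).trans (hgr z hz)
    have h3 := hD₁ z.2
    have h4 := hD₂ z.1
    have h5 : ε * (log (1 + z.1 ^ 2) + 2 * z.2 - log z.2) ≤ C + D₁ + D₂ := by
      have := mul_le_mul_of_nonneg_left h1 hε.le
      simp only [hφ] at hpos
      nlinarith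
    have h6 : log (1 + z.1 ^ 2) + 2 * z.2 - log z.2 ≤ L := by
      rw [hL, le_div_iff₀ hε]; linarith
    have hlx : 0 ≤ log (1 + z.1 ^ 2) := log_nonneg (by nlinarith [sq_nonneg z.1])
    have hly : log z.2 ≤ z.2 - 1 := log_le_sub_one_of_pos hy
    have hx : 1 + z.1 ^ 2 ≤ exp L := by
      rw [← log_le_iff_le_exp (by positivity)]; linarith
    have hx' : |z.1| ≤ exp L := by
      refine abs_le_of_sq_le_sq ?_ (exp_pos _).le
      have : 1 ≤ exp L := by nlinarith [sq_nonneg z.1]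
      nlinarith
    refine ⟨abs_le.1 hx', ?_, by linarith⟩
    rw [← le_log_iff_exp_le hy]
    linarith
  have hφz₀ : 0 < φ z₀ := by simp only [hφ]; linarith
  have hφc : ContinuousOn φ (closure O ∩ B) := by
    refine ((hu₁c.mono hsub).sub (hu₂c.mono hsub)).sub (continuousOn_const.mul ?_)
    intro z hz
    exact (hW z (hBH hz.2)).1.continuousAt.continuousWithinAt
  obtain ⟨z, hzK, hzmax⟩ := (hBc.inter_left isClosed_closure).exists_isMaxOn
    ⟨z₀, subset_closure hz₀, hout z₀ hz₀ hφz₀.le⟩ hφc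
  have hφz : 0 < φ z := hφz₀.trans_le (hzmax ⟨subset_closure hz₀, hout z₀ hz₀ hφz₀.le⟩)
  have hzH : 0 < z.2 := hBH hzK.2
  have hWz := hW z hzH
  have hεWz : 0 ≤ ε * W z := mul_nonneg hε.le hWz.2.2.1
  have hlt' : u₂ z < u₁ z := by
    simp only [hφ] at hφz; linarith
  have hzO : z ∈ O := by
    rcases hsub hzK with h | h
    · exact h
    · exact absurd (hb z h) hlt'.ne'
  have hloc : IsLocalMax φ z := by
    filter_upwards [hO.mem_nhds hzO] with p hp
    by_cases hp0 : 0 ≤ φ p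
    · exact hzmax ⟨subset_closure hp, hout p hp hp0⟩
    · linarith
  have hc1 := hu₁d.contDiffAt (hO.mem_nhds hzO)
  have hc2 := hu₂d.contDiffAt (hO.mem_nhds hzO)
  have hc3 : ContDiffAt ℝ 2 (fun p => ε * W p) z := contDiffAt_const.mul hWz.1
  have hge := hestonA_at_max σ ρ κ θ q r hρ₁ hρ₂ hzH ((hc1.sub hc2).sub hc3) hloc
  have heq : hestonA σ ρ κ θ q r φ z = hestonA σ ρ κ θ q r u₁ z - hestonA σ ρ κ θ q r u₂ z
      - ε * hestonA σ ρ κ θ q r W z := by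
    rw [← hestonA_smul σ ρ κ θ q r ε hWz.1, ← hestonA_sub σ ρ κ θ q r hc1 hc2]
    exact hestonA_sub σ ρ κ θ q r (hc1.sub hc2) hc3
  have hge' : r * φ z ≤ hestonA σ ρ κ θ q r φ z := hge
  rw [heq] at hge'
  have e1 := hu₁eq z hzO
  have e2 := hu₂eq z hzO
  have e3 : hestonA σ ρ κ θ q r u₁ z = f z := by
    rcases e1.2.2 with h | h
    · exact h
    · linarith [e2.2.1]
  have p1 := mul_pos hε hWz.2.1
  have p2 := mul_pos hr hφz
  linarith [e2.1]

/-- Uniqueness of solutions to the elliptic Heston obstacle problem when `β ≥ 1`. -/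
theorem heston_elliptic_obstacle_uniqueness_beta_ge_one
    (σ ρ κ θ q r : ℝ) (hσ : σ ≠ 0) (hρ₁ : -1 < ρ) (hρ₂ : ρ < 1)
    (hκ : 0 < κ) (hθ : 0 < θ) (hr : 0 < r) (hq : 0 ≤ q)
    (hβ : 1 ≤ 2 * κ * θ / σ ^ 2)
    (O : Set (ℝ × ℝ)) (hO : IsOpen O) (hOconn : IsConnected O) (hOsub : O ⊆ HH)
    (hΓ₀ : (Gamma0 O).Nonempty)
    (f ψ g u₁ u₂ : ℝ × ℝ → ℝ)
    (hf : ContinuousOn f O) (hfg : ellGrowth σ κ θ r O f)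
    (hψ : ContinuousOn ψ (O ∪ Gamma1 O)) (hψg : ellGrowth σ κ θ r (O ∪ Gamma1 O) ψ)
    (hg : ContinuousOn g (Gamma1 O)) (hgg : ellGrowth σ κ θ r (Gamma1 O) g)
    (hψg' : ∀ z ∈ Gamma1 O, ψ z ≤ g z)
    (hu₁c : ContinuousOn u₁ (O ∪ Gamma1 O)) (hu₁d : ContDiffOn ℝ 2 u₁ O)
    (hu₁g : ellGrowth σ κ θ r O u₁)
    (hAu₁g : ellGrowth σ κ θ r O (hestonA σ ρ κ θ q r u₁))
    (hu₁eq : obstacleProblem σ ρ κ θ q r O f ψ u₁)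
    (hu₁b : ∀ z ∈ Gamma1 O, u₁ z = g z)
    (hu₂c : ContinuousOn u₂ (O ∪ Gamma1 O)) (hu₂d : ContDiffOn ℝ 2 u₂ O)
    (hu₂g : ellGrowth σ κ θ r O u₂)
    (hAu₂g : ellGrowth σ κ θ r O (hestonA σ ρ κ θ q r u₂))
    (hu₂eq : obstacleProblem σ ρ κ θ q r O f ψ u₂)
    (hu₂b : ∀ z ∈ Gamma1 O, u₂ z = g z) :
    EqOn u₁ u₂ (O ∪ Gamma1 O) := by
  rintro z (hz | hz)
  · exact le_antisymm
      (heston_comparison σ ρ κ θ q r hσ hρ₁ hρ₂ hκ hθ hr hq hβ O hO hOsub f ψ u₁ u₂ hu₁c hu₁d hu₁g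
        hu₁eq hu₂c hu₂d hu₂g hu₂eq (fun z hz => (hu₁b z hz).trans (hu₂b z hz).symm) z hz)
      (heston_comparison σ ρ κ θ q r hσ hρ₁ hρ₂ hκ hθ hr hq hβ O hO hOsub f ψ u₂ u₁ hu₂c hu₂d hu₂g
        hu₂eq hu₁c hu₁d hu₁g hu₁eq (fun z hz => (hu₂b z hz).trans (hu₁b z hz).symm) z hz)
  · exact (hu₁b z hz).trans (hu₂b z hz).symm

end
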